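/- For every summable f : ℤ → ℝ and every x ∈ ℤ, G(f)(x) ≤ √2 · G_*(f)(x), where G(f)(x) = (∫₀^∞ |∇(P_t f)|²(x) dt)^{1/2} and G_*(f)(x) = (∫₀^∞ Σ_{y,z∈ℤ} |P_t f(z+y) − P_t f(z)|² · p_t(x,z) · K_s(y) dt)^{1/2}. -/

import Mathlib

open MeasureTheory Real

/-- The kernel `K_s` of the fractional discrete Laplacian on `ℤ`. -/
noncomputable def Ker (s : ℝ) (m : ℤ) : ℝ :=
  if m = 0 then 0
  else ((4 : ℝ) ^ s * Real.Gamma (1 / 2 + s) / (Real.sqrt Real.pi * |Real.Gamma (-s)|)) *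
    (Real.Gamma ((m.natAbs : ℝ) - s) / Real.Gamma ((m.natAbs : ℝ) + 1 + s))

/-- The fractional discrete Laplacian `L = (-Δ)^s` acting pointwise. -/
noncomputable def Lop (s : ℝ) (f : ℤ → ℝ) : ℤ → ℝ :=
  fun x => ∑' y : ℤ, (f x - f y) * Ker s (x - y)

/-- The heat semigroup `P_t = exp (-t L)`, given by the exponential series of the
bounded operator `-tL` (evaluated pointwise). -/
noncomputable def heat (s t : ℝ) (f : ℤ → ℝ) : ℤ → ℝ :=
  fun x => ∑' n : ℕ, ((-t) ^ n / (n.factorial : ℝ)) * ((Lop s)^[n] f x)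

/-- The squared modulus of the gradient, `|∇f|²(x) = Σ_y K_s(y-x) (f x - f y)²`. -/
noncomputable def gradSq (s : ℝ) (f : ℤ → ℝ) (x : ℤ) : ℝ :=
  ∑' y : ℤ, Ker s (y - x) * (f x - f y) ^ 2

/-- The squared modulus of the modified gradient,
`|∇̃f|²(x) = Σ_{y : |f y| < |f x|} K_s(y-x) (f x - f y)²`. -/
noncomputable def mgradSq (s : ℝ) (f : ℤ → ℝ) (x : ℤ) : ℝ :=
  ∑' y : {y : ℤ // |f y| < |f x|}, Ker s ((y : ℤ) - x) * (f x - f (y : ℤ)) ^ 2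

/-- The `ℓ^q` norm on `ℤ` with counting measure (for finite `q`). -/
noncomputable def lqNorm (q : ℝ) (f : ℤ → ℝ) : ℝ :=
  (∑' x : ℤ, |f x| ^ q) ^ (1 / q)

/-- The heat kernel `p_t(x,z) = (P_t δ_z)(x)`. -/
noncomputable def hker (s t : ℝ) (x z : ℤ) : ℝ :=
  heat s t (fun y => if y = z then (1 : ℝ) else 0) x

/-- Coordinate translation `u ↦ u (· + m)` on `ℓ²(ℤ)`. -/
noncomputable def shift (m : ℤ) : lp (fun _ : ℤ => ℝ) 2 →L[ℝ] lp (fun _ : ℤ => ℝ) 2 :=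
  LinearMap.mkContinuous
    { toFun := fun u => ⟨fun z => u (z + m), by
        have h := (memℓp_gen_iff (by simp)).1 (lp.memℓp u)
        exact (memℓp_gen_iff (by simp)).2 ((Equiv.addRight m).summable_iff.2 h)⟩
      map_add' := fun _ _ => rfl
      map_smul' := fun _ _ => rfl } 1 (by
    intro u
    rw [one_mul, lp.norm_eq_tsum_rpow (by simp), lp.norm_eq_tsum_rpow (by simp)]
    exact le_of_eq (congrArg (· ^ _)
      ((Equiv.addRight m).tsum_eq (fun z => ‖u z‖ ^ (2 : ENNReal).toReal))))

lemma shift_apply (m : ℤ) (u : lp (fun _ : ℤ => ℝ) 2) (z : ℤ) : shift m u z = u (z + m) := rfl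

lemma norm_shift_le (m : ℤ) : ‖shift m‖ ≤ 1 := LinearMap.mkContinuous_norm_le _ zero_le_one _

lemma norm_sq_eq_tsum (u : lp (fun _ : ℤ => ℝ) 2) : ‖u‖ ^ 2 = ∑' z, u z ^ 2 := by
  rw [← real_inner_self_eq_norm_sq, lp.inner_eq_tsum]
  exact tsum_congr fun z => by rw [real_inner_self_eq_norm_sq, Real.norm_eq_abs, sq_abs]

lemma summable_sq (u : lp (fun _ : ℤ => ℝ) 2) : Summable fun z => u z ^ 2 :=
  (lp.summable_inner (𝕜 := ℝ) u u).congr fun z => by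
    rw [real_inner_self_eq_norm_sq, Real.norm_eq_abs, sq_abs]

lemma norm_shift_apply (m : ℤ) (u : lp (fun _ : ℤ => ℝ) 2) : ‖shift m u‖ = ‖u‖ := by
  have h : ‖shift m u‖ ^ 2 = ‖u‖ ^ 2 := by
    rw [norm_sq_eq_tsum, norm_sq_eq_tsum]
    exact (Equiv.addRight m).tsum_eq (fun z => u z ^ 2)
  exact (sq_eq_sq₀ (norm_nonneg _) (norm_nonneg _)).1 h

lemma shift_commute (m n : ℤ) : Commute (shift m) (shift n) := by
  ext u z
  simp [shift_apply, add_right_comm]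

/-- The averaging operator `u ↦ ∑ m, K m * u (· + m)`. -/
noncomputable def jump (K : ℤ → ℝ) : lp (fun _ : ℤ => ℝ) 2 →L[ℝ] lp (fun _ : ℤ => ℝ) 2 :=
  ∑' m, K m • shift m

/-- The generator `u ↦ ∑ m, K m * (u - u (· + m))`. -/
noncomputable def gen (K : ℤ → ℝ) : lp (fun _ : ℤ => ℝ) 2 →L[ℝ] lp (fun _ : ℤ => ℝ) 2 :=
  (∑' m, K m) • 1 - jump K

/-- The semigroup `exp (-t L)` generated by `gen K`. -/
noncomputable def semigroup (K : ℤ → ℝ) (t : ℝ) :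
    lp (fun _ : ℤ => ℝ) 2 →L[ℝ] lp (fun _ : ℤ => ℝ) 2 :=
  NormedSpace.exp (t • -gen K)

/-- The point mass at `z` in `ℓ²(ℤ)`. -/
noncomputable def pointMass (z : ℤ) : lp (fun _ : ℤ => ℝ) 2 := lp.single 2 z 1

lemma pointMass_apply (z y : ℤ) : pointMass z y = if y = z then 1 else 0 := by
  simp [pointMass, lp.single_apply, Pi.single_apply]

section Kernel

variable {K : ℤ → ℝ}

lemma summable_smul_shift (hK : Summable K) (h0 : ∀ m, 0 ≤ K m) :
    Summable fun m => K m • shift m :=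
  Summable.of_norm_bounded hK fun m => by
    rw [norm_smul, Real.norm_of_nonneg (h0 m)]
    exact mul_le_of_le_one_right (h0 m) (norm_shift_le m)

lemma hasSum_jump_apply (hK : Summable K) (h0 : ∀ m, 0 ≤ K m) (u : lp (fun _ : ℤ => ℝ) 2) :
    HasSum (fun m => K m • shift m u) (jump K u) :=
  (summable_smul_shift hK h0).hasSum.map
    (AddMonoidHom.mk' (fun A : lp (fun _ : ℤ => ℝ) 2 →L[ℝ] lp (fun _ : ℤ => ℝ) 2 => A u) fun _ _ => rfl)
    (ContinuousLinearMap.apply ℝ (lp (fun _ : ℤ => ℝ) 2) u).continuous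

lemma hasSum_jump_coord (hK : Summable K) (h0 : ∀ m, 0 ≤ K m) (u : lp (fun _ : ℤ => ℝ) 2)
    (z : ℤ) : HasSum (fun m => K m * u (z + m)) (jump K u z) :=
  (lp.evalCLM ℝ (fun _ : ℤ => ℝ) 2 z).hasSum (hasSum_jump_apply hK h0 u)

lemma gen_coord (hK : Summable K) (h0 : ∀ m, 0 ≤ K m) (heven : ∀ m, K (-m) = K m)
    (u : lp (fun _ : ℤ => ℝ) 2) (z : ℤ) :
    gen K u z = ∑' y : ℤ, (u z - u y) * K (z - y) := by
  have h : HasSum (fun m => K m * u z - K m * u (z + m)) (gen K u z) :=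
    (hK.hasSum.mul_right (u z)).sub (hasSum_jump_coord hK h0 u z)
  rw [← h.tsum_eq, ← (Equiv.addLeft z).tsum_eq (fun y => (u z - u y) * K (z - y))]
  refine tsum_congr fun m => ?_
  simp only [Equiv.coe_addLeft]
  rw [show z - (z + m) = -m by ring, heven]
  ring

lemma shift_commute_jump (hK : Summable K) (h0 : ∀ m, 0 ≤ K m) (m : ℤ) :
    Commute (shift m) (jump K) := by
  have h := summable_smul_shift hK h0
  rw [Commute, SemiconjBy, jump, ← h.tsum_mul_left, ← h.tsum_mul_right]
  exact tsum_congr fun n => ((shift_commute m n).smul_right (K n)).eq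

lemma shift_commute_semigroup (hK : Summable K) (h0 : ∀ m, 0 ≤ K m) (m : ℤ) (t : ℝ) :
    Commute (shift m) (semigroup K t) :=
  Commute.exp_right ((((Commute.one_right _).smul_right _).sub_right
    (shift_commute_jump hK h0 m)).neg_right.smul_right t)

lemma semigroup_add (K : ℤ → ℝ) (s t : ℝ) :
    semigroup K (s + t) = semigroup K s * semigroup K t := by
  let _ : NormedAlgebra ℚ (lp (fun _ : ℤ => ℝ) 2 →L[ℝ] lp (fun _ : ℤ => ℝ) 2) :=
    NormedAlgebra.restrictScalars ℚ ℝ _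
  rw [semigroup, add_smul]
  exact NormedSpace.exp_add_of_commute (((Commute.refl _).smul_left s).smul_right t)

lemma hasSum_exp_coord (A : lp (fun _ : ℤ => ℝ) 2 →L[ℝ] lp (fun _ : ℤ => ℝ) 2) (t : ℝ)
    (u : lp (fun _ : ℤ => ℝ) 2) (z : ℤ) :
    HasSum (fun n : ℕ => t ^ n / (n.factorial : ℝ) * (A ^ n) u z)
      (NormedSpace.exp (t • A) u z) := by
  have h := NormedSpace.exp_series_hasSum_exp' (𝕂 := ℝ) (t • A)
  have h2 := (lp.evalCLM ℝ (fun _ : ℤ => ℝ) 2 z).hasSum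
    ((ContinuousLinearMap.apply ℝ _ u).hasSum h)
  refine h2.congr_fun ?_
  intro n
  change t ^ n / (n.factorial : ℝ) * (A ^ n) u z = (n.factorial : ℝ)⁻¹ * ((t • A) ^ n) u z
  rw [smul_pow]
  change _ = (n.factorial : ℝ)⁻¹ * (t ^ n * (A ^ n) u z)
  ring

lemma semigroup_eq_smul (K : ℤ → ℝ) (t : ℝ) :
    semigroup K t = Real.exp (-(t * ∑' m, K m)) • NormedSpace.exp (t • jump K) := by
  let _ : NormedAlgebra ℚ (lp (fun _ : ℤ => ℝ) 2 →L[ℝ] lp (fun _ : ℤ => ℝ) 2) :=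
    NormedAlgebra.restrictScalars ℚ ℝ _
  have h : t • -gen K = algebraMap ℝ _ (-(t * ∑' m, K m)) + t • jump K := by
    rw [gen, Algebra.algebraMap_eq_smul_one, neg_sub, smul_sub, smul_smul, neg_smul]
    abel
  rw [semigroup, h, NormedSpace.exp_add_of_commute (Algebra.commutes _ _),
    ← NormedSpace.algebraMap_exp_comm, ← Algebra.smul_def, Real.exp_eq_exp_ℝ]

lemma jump_pow_bounds (hK : Summable K) (h0 : ∀ m, 0 ≤ K m) {u : lp (fun _ : ℤ => ℝ) 2}
    (hu0 : ∀ z, 0 ≤ u z) {c : ℝ} (huc : ∀ z, u z ≤ c) (n : ℕ) (z : ℤ) :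
    0 ≤ (jump K ^ n) u z ∧ (jump K ^ n) u z ≤ (∑' m, K m) ^ n * c := by
  induction n generalizing z with
  | zero => simpa using ⟨hu0 z, huc z⟩
  | succ n ih =>
    rw [pow_succ', mul_apply_eq_comp]
    have h := hasSum_jump_coord hK h0 ((jump K ^ n) u) z
    refine ⟨h.nonneg fun m => mul_nonneg (h0 m) (ih _).1, ?_⟩
    rw [pow_succ', mul_assoc]
    exact hasSum_le (fun m => mul_le_mul_of_nonneg_left (ih _).2 (h0 m)) h
      (hK.hasSum.mul_right _)

lemma semigroup_bounds (hK : Summable K) (h0 : ∀ m, 0 ≤ K m) {u : lp (fun _ : ℤ => ℝ) 2}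
    (hu0 : ∀ z, 0 ≤ u z) {c : ℝ} (huc : ∀ z, u z ≤ c) {t : ℝ} (ht : 0 ≤ t) (z : ℤ) :
    0 ≤ semigroup K t u z ∧ semigroup K t u z ≤ c := by
  have h := hasSum_exp_coord (jump K) t u z
  have hb := jump_pow_bounds hK h0 hu0 huc
  have e : semigroup K t u z =
      Real.exp (-(t * ∑' m, K m)) * NormedSpace.exp (t • jump K) u z := by
    rw [semigroup_eq_smul]; rfl
  have hexp : HasSum (fun n : ℕ => t ^ n / (n.factorial : ℝ) * ((∑' m, K m) ^ n * c))
      (Real.exp (t * ∑' m, K m) * c) := by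
    have := (NormedSpace.exp_series_hasSum_exp' (𝕂 := ℝ) (t * ∑' m, K m)).mul_right c
    rw [← Real.exp_eq_exp_ℝ] at this
    refine this.congr_fun fun n => ?_
    simp only [smul_eq_mul, mul_pow]
    ring
  rw [e]
  refine ⟨mul_nonneg (Real.exp_pos _).le
    (h.nonneg fun n => mul_nonneg (by positivity) (hb n z).1), ?_⟩
  calc _ ≤ Real.exp (-(t * ∑' m, K m)) * (Real.exp (t * ∑' m, K m) * c) :=
        mul_le_mul_of_nonneg_left
          (hasSum_le (fun n => mul_le_mul_of_nonneg_left (hb n z).2 (by positivity)) h hexp)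
          (Real.exp_pos _).le
    _ = c := by rw [← mul_assoc, ← Real.exp_add]; simp

lemma hasSum_semigroup_coord (K : ℤ → ℝ) (t : ℝ) (u : lp (fun _ : ℤ => ℝ) 2) (x : ℤ) :
    HasSum (fun z => semigroup K t (pointMass z) x * u z) (semigroup K t u x) := by
  have h := (lp.evalCLM ℝ (fun _ : ℤ => ℝ) 2 x).hasSum
    ((semigroup K t).hasSum (lp.hasSum_single ENNReal.ofNat_ne_top u))
  refine h.congr_fun fun z => ?_
  have : lp.single 2 z (u z) = u z • pointMass z := by
    rw [pointMass, ← lp.single_smul]; simp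
  simp [this, lp.evalCLM, mul_comm]

lemma semigroup_pointMass_nonneg (hK : Summable K) (h0 : ∀ m, 0 ≤ K m) {t : ℝ} (ht : 0 ≤ t)
    (x z : ℤ) : 0 ≤ semigroup K t (pointMass z) x :=
  (semigroup_bounds hK h0 (c := 1) (fun y => by rw [pointMass_apply]; positivity)
    (fun y => by rw [pointMass_apply]; split_ifs <;> simp) ht x).1

lemma sum_semigroup_pointMass_le_one (hK : Summable K) (h0 : ∀ m, 0 ≤ K m) {t : ℝ} (ht : 0 ≤ t)
    (x : ℤ) (F : Finset ℤ) : ∑ z ∈ F, semigroup K t (pointMass z) x ≤ 1 := by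
  have hc (y : ℤ) : (∑ z ∈ F, pointMass z : lp (fun _ : ℤ => ℝ) 2) y =
      if y ∈ F then 1 else 0 := by
    rw [lp.coeFn_sum, Finset.sum_apply]
    simp [pointMass_apply]
  have h := (semigroup_bounds hK h0 (u := ∑ z ∈ F, pointMass z) (c := 1)
    (fun y => by rw [hc]; positivity) (fun y => by rw [hc]; split_ifs <;> simp) ht x).2
  rwa [map_sum, lp.coeFn_sum, Finset.sum_apply] at h

lemma semigroup_pointMass_le_one (hK : Summable K) (h0 : ∀ m, 0 ≤ K m) {t : ℝ} (ht : 0 ≤ t)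
    (x z : ℤ) : semigroup K t (pointMass z) x ≤ 1 := by
  simpa using sum_semigroup_pointMass_le_one hK h0 ht x {z}

lemma summable_semigroup_mul_sq (hK : Summable K) (h0 : ∀ m, 0 ≤ K m) {t : ℝ} (ht : 0 ≤ t)
    (u : lp (fun _ : ℤ => ℝ) 2) (x : ℤ) :
    Summable fun z => u z ^ 2 * semigroup K t (pointMass z) x :=
  Summable.of_nonneg_of_le
    (fun z => mul_nonneg (sq_nonneg _) (semigroup_pointMass_nonneg hK h0 ht x z))
    (fun z => mul_le_of_le_one_right (sq_nonneg _) (semigroup_pointMass_le_one hK h0 ht x z))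
    (summable_sq u)

lemma tsum_semigroup_mul_sq_le (hK : Summable K) (h0 : ∀ m, 0 ≤ K m) {t : ℝ} (ht : 0 ≤ t)
    (u : lp (fun _ : ℤ => ℝ) 2) (x : ℤ) :
    ∑' z, u z ^ 2 * semigroup K t (pointMass z) x ≤ ‖u‖ ^ 2 := by
  rw [norm_sq_eq_tsum]
  exact (summable_semigroup_mul_sq hK h0 ht u x).tsum_le_tsum
    (fun z => mul_le_of_le_one_right (sq_nonneg _) (semigroup_pointMass_le_one hK h0 ht x z))
    (summable_sq u)

lemma sq_semigroup_le (hK : Summable K) (h0 : ∀ m, 0 ≤ K m) {t : ℝ} (ht : 0 ≤ t)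
    (u : lp (fun _ : ℤ => ℝ) 2) (x : ℤ) :
    semigroup K t u x ^ 2 ≤ ∑' z, u z ^ 2 * semigroup K t (pointMass z) x := by
  have hp := semigroup_pointMass_nonneg hK h0 ht x
  refine le_of_tendsto ((hasSum_semigroup_coord K t u x).pow 2) (Filter.Eventually.of_forall ?_)
  intro F
  have hnn : ∀ z, 0 ≤ u z ^ 2 * semigroup K t (pointMass z) x :=
    fun z => mul_nonneg (sq_nonneg _) (hp z)
  calc (∑ z ∈ F, semigroup K t (pointMass z) x * u z) ^ 2
      ≤ (∑ z ∈ F, semigroup K t (pointMass z) x) *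
          ∑ z ∈ F, u z ^ 2 * semigroup K t (pointMass z) x :=
        Finset.sum_sq_le_sum_mul_sum_of_sq_le_mul F (fun z _ => hp z) (fun z _ => hnn z)
          fun z _ => le_of_eq (by ring)
    _ ≤ 1 * ∑ z ∈ F, u z ^ 2 * semigroup K t (pointMass z) x :=
        mul_le_mul_of_nonneg_right (sum_semigroup_pointMass_le_one hK h0 ht x F)
          (Finset.sum_nonneg fun z _ => hnn z)
    _ ≤ _ := by
        rw [one_mul]
        exact (summable_semigroup_mul_sq hK h0 ht u x).sum_le_tsum F fun z _ => hnn z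

lemma norm_shift_sub_sq_le (m : ℤ) (u : lp (fun _ : ℤ => ℝ) 2) :
    ‖shift m u - u‖ ^ 2 ≤ (2 * ‖u‖) ^ 2 := by
  have h := norm_sub_le (shift m u) u
  rw [norm_shift_apply, ← two_mul] at h
  gcongr

lemma summable_mul_norm_shift_sub_sq (hK : Summable K) (h0 : ∀ m, 0 ≤ K m)
    (u : lp (fun _ : ℤ => ℝ) 2) : Summable fun y => ‖shift y u - u‖ ^ 2 * K y :=
  Summable.of_nonneg_of_le (fun y => mul_nonneg (sq_nonneg _) (h0 y))
    (fun y => mul_le_mul_of_nonneg_right (norm_shift_sub_sq_le y u) (h0 y)) (hK.mul_left _)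

lemma hasSum_dirichlet (hK : Summable K) (h0 : ∀ m, 0 ≤ K m) (u : lp (fun _ : ℤ => ℝ) 2) :
    HasSum (fun y => ‖shift y u - u‖ ^ 2 * K y) (2 * inner ℝ u (gen K u)) := by
  have h1 := (innerSL ℝ u).hasSum (hasSum_jump_apply hK h0 u)
  have h2 := ((hK.hasSum.mul_right (‖u‖ ^ 2)).sub h1).mul_left 2
  have e : inner ℝ u (gen K u) = (∑' m, K m) * ‖u‖ ^ 2 - innerSL ℝ u (jump K u) := by
    simp [gen, inner_sub_right, inner_smul_right]
  rw [e]
  refine h2.congr_fun fun y => ?_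
  rw [norm_sub_sq_real, norm_shift_apply]
  simp only [innerSL_apply_apply, inner_smul_right, real_inner_comm]
  ring

lemma hasDerivAt_semigroup_apply (K : ℤ → ℝ) (u : lp (fun _ : ℤ => ℝ) 2) (t : ℝ) :
    HasDerivAt (fun t => semigroup K t u) (-gen K (semigroup K t u)) t := by
  have h := (hasDerivAt_exp_smul_const' (𝕂 := ℝ) (-gen K) t)
  exact ((ContinuousLinearMap.apply ℝ _ u).hasFDerivAt.comp_hasDerivAt t h)

lemma continuous_semigroup_apply (K : ℤ → ℝ) (u : lp (fun _ : ℤ => ℝ) 2) :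
    Continuous fun t => semigroup K t u :=
  continuous_iff_continuousAt.2 fun t => (hasDerivAt_semigroup_apply K u t).continuousAt

lemma continuous_semigroup_coord (K : ℤ → ℝ) (u : lp (fun _ : ℤ => ℝ) 2) (z : ℤ) :
    Continuous fun t => semigroup K t u z :=
  (lp.evalCLM ℝ (fun _ : ℤ => ℝ) 2 z).continuous.comp (continuous_semigroup_apply K u)

lemma integrableOn_dirichlet (hK : Summable K) (h0 : ∀ m, 0 ≤ K m)
    (u : lp (fun _ : ℤ => ℝ) 2) :
    IntegrableOn (fun t => 2 * inner ℝ (semigroup K t u) (gen K (semigroup K t u)))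
      (Set.Ioi 0) := by
  have hcont : Continuous fun t => 2 * inner ℝ (semigroup K t u) (gen K (semigroup K t u)) :=
    continuous_const.mul ((continuous_semigroup_apply K u).inner
      ((gen K).continuous.comp (continuous_semigroup_apply K u)))
  have hnn (t : ℝ) : 0 ≤ 2 * inner ℝ (semigroup K t u) (gen K (semigroup K t u)) :=
    (hasSum_dirichlet hK h0 _).nonneg fun y => mul_nonneg (sq_nonneg _) (h0 y)
  refine integrableOn_Ioi_of_intervalIntegral_norm_bounded (b := fun n : ℕ => (n : ℝ))
    (l := Filter.atTop) (‖semigroup K 0 u‖ ^ 2) 0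
    (fun n => hcont.integrableOn_Ioc) tendsto_natCast_atTop_atTop
    (Filter.Eventually.of_forall fun n => ?_)
  simp only [Real.norm_of_nonneg (hnn _)]
  have hd (t : ℝ) : HasDerivAt (fun t => -‖semigroup K t u‖ ^ 2)
      (2 * inner ℝ (semigroup K t u) (gen K (semigroup K t u))) t := by
    have := (hasDerivAt_semigroup_apply K u t).norm_sq.neg
    rwa [inner_neg_right, mul_neg, neg_neg] at this
  rw [intervalIntegral.integral_eq_sub_of_hasDerivAt (fun t _ => hd t)
    (hcont.intervalIntegrable _ _)]
  nlinarith [sq_nonneg ‖semigroup K (n : ℝ) u‖]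

lemma summable_averaged (hK : Summable K) (h0 : ∀ m, 0 ≤ K m) {t : ℝ} (ht : 0 ≤ t)
    (u : lp (fun _ : ℤ => ℝ) 2) (x : ℤ) :
    Summable fun p : ℤ × ℤ =>
      (u (p.2 + p.1) - u p.2) ^ 2 * semigroup K t (pointMass p.2) x * K p.1 := by
  have hp := semigroup_pointMass_nonneg hK h0 ht x
  refine (summable_prod_of_nonneg fun p =>
    mul_nonneg (mul_nonneg (sq_nonneg _) (hp _)) (h0 _)).2 ⟨fun y => ?_, ?_⟩
  · exact (summable_semigroup_mul_sq hK h0 ht (shift y u - u) x).mul_right (K y)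
  · refine Summable.of_nonneg_of_le (fun y => tsum_nonneg fun z =>
      mul_nonneg (mul_nonneg (sq_nonneg _) (hp _)) (h0 _)) (fun y => ?_)
      (summable_mul_norm_shift_sub_sq hK h0 u)
    exact tsum_mul_right.le.trans <| mul_le_mul_of_nonneg_right
      (tsum_semigroup_mul_sq_le hK h0 ht (shift y u - u) x) (h0 y)

lemma tsum_averaged_le (hK : Summable K) (h0 : ∀ m, 0 ≤ K m) {t : ℝ} (ht : 0 ≤ t)
    (u : lp (fun _ : ℤ => ℝ) 2) (x : ℤ) :
    ∑' p : ℤ × ℤ, (u (p.2 + p.1) - u p.2) ^ 2 * semigroup K t (pointMass p.2) x * K p.1 ≤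
      2 * inner ℝ u (gen K u) := by
  have hs := summable_averaged hK h0 ht u x
  rw [hs.tsum_prod, ← (hasSum_dirichlet hK h0 u).tsum_eq]
  refine Summable.tsum_le_tsum (fun y => ?_) hs.prod (summable_mul_norm_shift_sub_sq hK h0 u)
  exact tsum_mul_right.le.trans <| mul_le_mul_of_nonneg_right
    (tsum_semigroup_mul_sq_le hK h0 ht (shift y u - u) x) (h0 y)

lemma integrableOn_averaged (hK : Summable K) (h0 : ∀ m, 0 ≤ K m)
    (u : lp (fun _ : ℤ => ℝ) 2) (x : ℤ) :
    IntegrableOn (fun t => ∑' p : ℤ × ℤ,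
      (semigroup K t u (p.2 + p.1) - semigroup K t u p.2) ^ 2 *
        semigroup K t (pointMass p.2) x * K p.1) (Set.Ioi 0) := by
  refine Integrable.mono' (integrableOn_dirichlet hK h0 u) ?_ ?_
  · refine (Measurable.tsum fun p => Continuous.measurable ?_).aestronglyMeasurable
    have h1 : Continuous fun t => (semigroup K t u (p.2 + p.1) : ℝ) :=
      continuous_semigroup_coord K u _
    have h2 : Continuous fun t => (semigroup K t u p.2 : ℝ) := continuous_semigroup_coord K u _
    have h3 : Continuous fun t => (semigroup K t (pointMass p.2) x : ℝ) :=
      continuous_semigroup_coord K _ x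
    exact (((h1.sub h2).pow 2).mul h3).mul continuous_const
  · filter_upwards [ae_restrict_mem measurableSet_Ioi] with t ht
    have ht' : 0 ≤ t := le_of_lt ht
    rw [Real.norm_of_nonneg (tsum_nonneg fun p => mul_nonneg (mul_nonneg (sq_nonneg _)
      (semigroup_pointMass_nonneg hK h0 ht' x _)) (h0 _))]
    exact tsum_averaged_le hK h0 ht' _ x

/-- The carré du champ of `P_{2t} u` is dominated by the `P_t`-average of that of `P_t u`. -/
lemma tsum_sq_semigroup_two_mul_le (hK : Summable K) (h0 : ∀ m, 0 ≤ K m) {t : ℝ} (ht : 0 ≤ t)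
    (u : lp (fun _ : ℤ => ℝ) 2) (x : ℤ) :
    ∑' y, K (y - x) * (semigroup K (t + t) u x - semigroup K (t + t) u y) ^ 2 ≤
      ∑' p : ℤ × ℤ, (semigroup K t u (p.2 + p.1) - semigroup K t u p.2) ^ 2 *
        semigroup K t (pointMass p.2) x * K p.1 := by
  have hs := summable_averaged hK h0 ht (semigroup K t u) x
  rw [hs.tsum_prod, ← (Equiv.addLeft x).tsum_eq]
  have key (y : ℤ) : K (x + y - x) *
      (semigroup K (t + t) u x - semigroup K (t + t) u (x + y)) ^ 2 ≤
      ∑' z, (semigroup K t u (z + y) - semigroup K t u z) ^ 2 *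
        semigroup K t (pointMass z) x * K y := by
    have hc : semigroup K t (shift y (semigroup K t u) - semigroup K t u) x =
        semigroup K (t + t) u (x + y) - semigroup K (t + t) u x := by
      have h := congrArg (fun A => A (semigroup K t u))
        (shift_commute_semigroup hK h0 y t).eq
      simp only [mul_apply_eq_comp] at h
      rw [map_sub, ← h, semigroup_add]
      rfl
    rw [tsum_mul_right, add_sub_cancel_left, mul_comm]
    refine mul_le_mul_of_nonneg_right ?_ (h0 y)
    rw [← neg_sub, neg_sq, ← hc]
    exact sq_semigroup_le hK h0 ht _ x
  refine Summable.tsum_le_tsum key (Summable.of_nonneg_of_le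
    (fun y => mul_nonneg (h0 _) (sq_nonneg _)) key hs.prod) hs.prod

end Kernel

lemma Ker_neg (s : ℝ) (m : ℤ) : Ker s (-m) = Ker s m := by simp [Ker]

lemma Ker_nonneg {s : ℝ} (hs : s ∈ Set.Ioo (0 : ℝ) 1) (m : ℤ) : 0 ≤ Ker s m := by
  obtain ⟨h0, h1⟩ := hs
  unfold Ker
  split_ifs with hm
  · exact le_rfl
  · have hm' : (1 : ℝ) ≤ m.natAbs := by
      exact_mod_cast Nat.one_le_iff_ne_zero.2 (Int.natAbs_ne_zero.2 hm)
    have a1 := (Real.Gamma_pos_of_pos (show 0 < 1 / 2 + s by linarith)).le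
    have a2 := (Real.Gamma_pos_of_pos (show 0 < (m.natAbs : ℝ) - s by linarith)).le
    have a3 := (Real.Gamma_pos_of_pos (show 0 < (m.natAbs : ℝ) + 1 + s by linarith)).le
    positivity

lemma summable_Gamma_ratio {s : ℝ} (hs : s ∈ Set.Ioo (0 : ℝ) 1) :
    Summable fun n : ℕ => Real.Gamma ((n + 1 : ℕ) - s) / Real.Gamma ((n + 1 : ℕ) + 1 + s) := by
  obtain ⟨h0, h1⟩ := hs
  set a : ℕ → ℝ := fun n => Real.Gamma ((n + 1 : ℕ) - s) / Real.Gamma ((n + 1 : ℕ) + s) with ha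
  have hpos (n : ℕ) : 0 < ((n + 1 : ℕ) : ℝ) - s := by
    have : (0 : ℝ) ≤ n := n.cast_nonneg
    push_cast; linarith
  have hpos' (n : ℕ) : 0 < ((n + 1 : ℕ) : ℝ) + s := by positivity
  have ha0 (n : ℕ) : 0 ≤ a n :=
    div_nonneg (Real.Gamma_pos_of_pos (hpos n)).le (Real.Gamma_pos_of_pos (hpos' n)).le
  have htel (n : ℕ) : Real.Gamma ((n + 1 : ℕ) - s) / Real.Gamma ((n + 1 : ℕ) + 1 + s) =
      (a n - a (n + 1)) / (2 * s) := by
    have e1 : (((n + 1 + 1 : ℕ) : ℝ) - s) = ((n + 1 : ℕ) : ℝ) - s + 1 := by push_cast; ring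
    have e2 : (((n + 1 + 1 : ℕ) : ℝ) + s) = ((n + 1 : ℕ) : ℝ) + s + 1 := by push_cast; ring
    have e3 : (((n + 1 : ℕ) : ℝ) + 1 + s) = ((n + 1 : ℕ) : ℝ) + s + 1 := by ring
    simp only [ha]
    rw [e1, e2, e3, Real.Gamma_add_one (hpos n).ne', Real.Gamma_add_one (hpos' n).ne']
    have g := (Real.Gamma_pos_of_pos (hpos' n)).ne'
    have g' := (hpos' n).ne'
    generalize Real.Gamma (((n + 1 : ℕ) : ℝ) + s) = A at *
    generalize Real.Gamma (((n + 1 : ℕ) : ℝ) - s) = B at *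
    generalize ((n + 1 : ℕ) : ℝ) = N at *
    field_simp
    ring
  refine summable_of_sum_range_le (c := a 0 / (2 * s)) (fun n => ?_) fun n => ?_
  · refine div_nonneg (Real.Gamma_pos_of_pos (hpos n)).le (Real.Gamma_pos_of_pos ?_).le
    positivity
  · simp only [htel]
    rw [← Finset.sum_div, Finset.sum_range_sub']
    gcongr
    linarith [ha0 n]

lemma summable_Ker {s : ℝ} (hs : s ∈ Set.Ioo (0 : ℝ) 1) : Summable (Ker s) := by
  have h : Summable fun n : ℕ => Ker s n := by
    rw [← summable_nat_add_iff 1]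
    refine ((summable_Gamma_ratio hs).mul_left
      ((4 : ℝ) ^ s * Real.Gamma (1 / 2 + s) / (Real.sqrt Real.pi * |Real.Gamma (-s)|))).congr ?_
    intro n
    rw [Ker, if_neg (by positivity), Int.natAbs_natCast]
  exact Summable.of_nat_of_neg h (by simpa only [Ker_neg] using h)

lemma Lop_iterate_coe {s : ℝ} (hs : s ∈ Set.Ioo (0 : ℝ) 1) (u : lp (fun _ : ℤ => ℝ) 2) (n : ℕ) :
    (Lop s)^[n] u = (gen (Ker s) ^ n) u := by
  induction n with
  | zero => simp
  | succ n ih =>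
    rw [Function.iterate_succ_apply', ih, pow_succ', mul_apply_eq_comp]
    funext z
    exact (gen_coord (summable_Ker hs) (Ker_nonneg hs) (Ker_neg s) _ z).symm

lemma heat_coe {s : ℝ} (hs : s ∈ Set.Ioo (0 : ℝ) 1) (t : ℝ) (u : lp (fun _ : ℤ => ℝ) 2) :
    heat s t u = semigroup (Ker s) t u := by
  funext z
  have h := hasSum_exp_coord (gen (Ker s)) (-t) u z
  rw [semigroup, smul_neg, ← neg_smul, ← h.tsum_eq]
  simp only [heat, Lop_iterate_coe hs]

lemma hker_eq {s : ℝ} (hs : s ∈ Set.Ioo (0 : ℝ) 1) (t : ℝ) (x z : ℤ) :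
    hker s t x z = semigroup (Ker s) t (pointMass z) x := by
  rw [← heat_coe hs, hker]
  congr 1
  funext y
  rw [pointMass_apply]

/-- Pointwise comparison `G f x ≤ √2 · G_* f x`, where
`G_* f x = (∫₀^∞ Σ_{y,z} |P_t f (z+y) - P_t f z|² p_t(x,z) K_s(y) dt)^{1/2}`. -/
theorem G_le_Gstar (s : ℝ) (hs : s ∈ Set.Ioo (0 : ℝ) 1) (f : ℤ → ℝ) (hf : Summable f)
    (x : ℤ) :
    Real.sqrt (∫ t in Set.Ioi (0 : ℝ), gradSq s (heat s t f) x) ≤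
      Real.sqrt 2 * Real.sqrt (∫ t in Set.Ioi (0 : ℝ),
        ∑' p : ℤ × ℤ,
          (heat s t f (p.2 + p.1) - heat s t f p.2) ^ 2 * hker s t x p.2 * Ker s p.1) := by
  have hK := summable_Ker hs
  have h0 := Ker_nonneg hs
  have hmem : Memℓp f 2 := Memℓp.of_exponent_ge (q := 1)
    ((memℓp_gen_iff (by simp)).2 (by simpa using hf.norm)) one_le_two
  obtain ⟨u, rfl⟩ : ∃ u : lp (fun _ : ℤ => ℝ) 2, f = u := ⟨⟨f, hmem⟩, rfl⟩
  simp only [heat_coe hs, hker_eq hs, gradSq]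
  have hint := integrableOn_averaged hK h0 u x
  set H : ℝ → ℝ := fun t => ∑' p : ℤ × ℤ,
      (semigroup (Ker s) t u (p.2 + p.1) - semigroup (Ker s) t u p.2) ^ 2 *
        semigroup (Ker s) t (pointMass p.2) x * Ker s p.1 with hH
  rw [← Real.sqrt_mul zero_le_two]
  refine Real.sqrt_le_sqrt ?_
  have hcomp : IntegrableOn (fun t => H (2⁻¹ * t)) (Set.Ioi 0) :=
    (integrableOn_Ioi_comp_mul_left_iff H 0 (by norm_num)).2 (by simpa using hint)
  have hscale : ∫ t in Set.Ioi (0 : ℝ), H (2⁻¹ * t) = 2 * ∫ t in Set.Ioi (0 : ℝ), H t := by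
    rw [integral_comp_mul_left_Ioi H 0 (by norm_num)]
    simp
  rw [← hscale]
  refine integral_mono_of_nonneg
    (Filter.Eventually.of_forall fun t => tsum_nonneg fun y => mul_nonneg (h0 _) (sq_nonneg _))
    hcomp ?_
  filter_upwards [ae_restrict_mem measurableSet_Ioi] with t ht
  have ht' : 0 ≤ 2⁻¹ * t := mul_nonneg (by norm_num) (le_of_lt ht)
  have h := tsum_sq_semigroup_two_mul_le hK h0 ht' u x
  rwa [show 2⁻¹ * t + 2⁻¹ * t = t by ring] at h
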